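/- For every natural number n ≥ 1, the number of triples (a,b,c) of positive integers with a ≤ b ≤ c, a + b + c = n, and G(a,b,c) = 0 is exactly ⌊n/3⌋. -/

import Mathlib

namespace SharingNim

/-- The moves of three-pile Sharing Nim: take `k ≥ 1` tokens from one pile and add them to
another pile, provided the receiving pile has at most as many tokens as the source pile
after the move (i.e. `2 * k` is at most the difference of the two piles). -/
def moves : ℕ × ℕ × ℕ → Finset (ℕ × ℕ × ℕ)
  | (a, b, c) =>
    ((Finset.Icc 1 ((b - a) / 2)).image fun k => (a + k, b - k, c)) ∪
    ((Finset.Icc 1 ((a - b) / 2)).image fun k => (a - k, b + k, c)) ∪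
    ((Finset.Icc 1 ((c - a) / 2)).image fun k => (a + k, b, c - k)) ∪
    ((Finset.Icc 1 ((a - c) / 2)).image fun k => (a - k, b, c + k)) ∪
    ((Finset.Icc 1 ((c - b) / 2)).image fun k => (a, b + k, c - k)) ∪
    ((Finset.Icc 1 ((b - c) / 2)).image fun k => (a, b - k, c + k))

/-- The sum of squares of the pile sizes, a measure that strictly decreases along
every move. -/
def measure3 (p : ℕ × ℕ × ℕ) : ℕ := p.1 ^ 2 + p.2.1 ^ 2 + p.2.2 ^ 2

theorem sq_move_lt {x y k : ℕ} (hk : 1 ≤ k) (h : k ≤ (y - x) / 2) :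
    (x + k) ^ 2 + (y - k) ^ 2 < x ^ 2 + y ^ 2 := by
  have h1 : x + 2 * k ≤ y := by omega
  have h2 : k ≤ y := by omega
  zify [h2]
  nlinarith

theorem measure3_lt_of_mem_moves {q p : ℕ × ℕ × ℕ} (h : q ∈ moves p) :
    measure3 q < measure3 p := by
  obtain ⟨a, b, c⟩ := p
  simp only [moves, Finset.mem_union, Finset.mem_image, Finset.mem_Icc] at h
  rcases h with ((((⟨k, ⟨hk1, hk2⟩, rfl⟩ | ⟨k, ⟨hk1, hk2⟩, rfl⟩) | ⟨k, ⟨hk1, hk2⟩, rfl⟩) |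
      ⟨k, ⟨hk1, hk2⟩, rfl⟩) | ⟨k, ⟨hk1, hk2⟩, rfl⟩) | ⟨k, ⟨hk1, hk2⟩, rfl⟩ <;>
    simp only [measure3] <;>
    [linarith [sq_move_lt (x := a) (y := b) hk1 hk2];
     linarith [sq_move_lt (x := b) (y := a) hk1 hk2];
     linarith [sq_move_lt (x := a) (y := c) hk1 hk2];
     linarith [sq_move_lt (x := c) (y := a) hk1 hk2];
     linarith [sq_move_lt (x := b) (y := c) hk1 hk2];
     linarith [sq_move_lt (x := c) (y := b) hk1 hk2]]

/-- The minimum excludant of a finite set of naturals. -/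
noncomputable def mex (s : Finset ℕ) : ℕ := sInf {n : ℕ | n ∉ s}

/-- The Sprague–Grundy value of a position of three-pile Sharing Nim: the minimum
excludant of the Sprague–Grundy values of the positions reachable in one move. -/
noncomputable def G (p : ℕ × ℕ × ℕ) : ℕ :=
  mex ((moves p).attach.image fun q => G q.1)
termination_by measure3 p
decreasing_by exact measure3_lt_of_mem_moves q.2

/-- Even 2-adic valuation (zero included). -/
def E (d : ℕ) : Prop := Even (padicValNat 2 d)

theorem E_zero : E 0 := by simp [E]

theorem E_two_mul {d : ℕ} (hd : 0 < d) : E (2 * d) ↔ ¬ E d := by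
  unfold E
  rw [padicValNat.mul (by norm_num) (by omega), padicValNat.self (by norm_num), add_comm,
    Nat.even_add_one]

theorem E_odd {d : ℕ} (hd : d % 2 = 1) : E d := by
  unfold E
  rw [padicValNat.eq_zero_of_not_dvd (by omega)]
  exact Even.zero

theorem not_E {d : ℕ} (h : ¬ E d) : ∃ e, 0 < e ∧ d = 2 * e ∧ E e := by
  have h0 : d ≠ 0 := by rintro rfl; exact h E_zero
  have h1 : d % 2 = 0 := by
    by_contra h1
    exact h (E_odd (by omega))
  refine ⟨d / 2, by omega, by omega, ?_⟩
  by_contra h2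
  apply h
  have h3 : d = 2 * (d / 2) := by omega
  rw [h3, E_two_mul (by omega)]
  exact h2

theorem mem_moves {x y z a b c : ℕ} : (x, y, z) ∈ moves (a, b, c) ↔
    (z = c ∧ x + y = a + b ∧ (a < x ∧ x ≤ y ∨ b < y ∧ y ≤ x)) ∨
    (y = b ∧ x + z = a + c ∧ (a < x ∧ x ≤ z ∨ c < z ∧ z ≤ x)) ∨
    (x = a ∧ y + z = b + c ∧ (b < y ∧ y ≤ z ∨ c < z ∧ z ≤ y)) := by
  simp only [moves, Finset.mem_union, Finset.mem_image, Finset.mem_Icc, Prod.mk.injEq]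
  constructor
  · rintro (((((⟨k, h⟩ | ⟨k, h⟩) | ⟨k, h⟩) | ⟨k, h⟩) | ⟨k, h⟩) | ⟨k, h⟩) <;> omega
  · rintro (⟨h1, h2, h | h⟩ | ⟨h1, h2, h | h⟩ | ⟨h1, h2, h | h⟩)
    · exact Or.inl (Or.inl (Or.inl (Or.inl (Or.inl ⟨x - a, by omega⟩))))
    · exact Or.inl (Or.inl (Or.inl (Or.inl (Or.inr ⟨y - b, by omega⟩))))
    · exact Or.inl (Or.inl (Or.inl (Or.inr ⟨x - a, by omega⟩)))
    · exact Or.inl (Or.inl (Or.inr ⟨z - c, by omega⟩))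
    · exact Or.inl (Or.inr ⟨y - b, by omega⟩)
    · exact Or.inr ⟨z - c, by omega⟩

theorem G_eq_zero_iff (p : ℕ × ℕ × ℕ) : G p = 0 ↔ ∀ q ∈ moves p, G q ≠ 0 := by
  rw [G, mex, Nat.sInf_eq_zero]
  constructor
  · rintro (h | h)
    · simpa using h
    · exfalso
      obtain ⟨m, hm⟩ := Infinite.exists_notMem_finset ((moves p).attach.image fun q => G q.1)
      have : m ∈ ({n : ℕ | n ∉ (moves p).attach.image fun q => G q.1}) := hm
      rw [h] at this
      exact this
  · intro h
    left
    simpa using h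

/-- Two piles are equal to `x`, the third is `y`, and `|x - y|` has even valuation. -/
def Q (p : ℕ × ℕ × ℕ) : Prop := ∃ x d, E d ∧
  (p = (x, x, x + d) ∨ p = (x, x + d, x) ∨ p = (x + d, x, x) ∨
   p = (x + d, x + d, x) ∨ p = (x + d, x, x + d) ∨ p = (x, x + d, x + d))

theorem no_move {p q : ℕ × ℕ × ℕ} (hp : Q p) (hq : q ∈ moves p) : ¬ Q q := by
  rintro ⟨x', e, he, hq'⟩
  obtain ⟨x, d, hd, hp⟩ := hp
  have key : 0 < e ∧ d = 2 * e := by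
    rcases hp with rfl | rfl | rfl | rfl | rfl | rfl <;>
    rcases hq' with rfl | rfl | rfl | rfl | rfl | rfl <;>
    rw [mem_moves] at hq <;> omega
  obtain ⟨h0, rfl⟩ := key
  exact (E_two_mul h0).1 hd he

theorem Q_swap12 {a b c : ℕ} (h : Q (a, b, c)) : Q (b, a, c) := by
  obtain ⟨x, d, hd, h⟩ := h
  refine ⟨x, d, hd, ?_⟩
  simp only [Prod.mk.injEq] at h ⊢
  rcases h with ⟨rfl, rfl, rfl⟩ | ⟨rfl, rfl, rfl⟩ | ⟨rfl, rfl, rfl⟩ | ⟨rfl, rfl, rfl⟩ |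
    ⟨rfl, rfl, rfl⟩ | ⟨rfl, rfl, rfl⟩ <;> simp

theorem Q_swap23 {a b c : ℕ} (h : Q (a, b, c)) : Q (a, c, b) := by
  obtain ⟨x, d, hd, h⟩ := h
  refine ⟨x, d, hd, ?_⟩
  simp only [Prod.mk.injEq] at h ⊢
  rcases h with ⟨rfl, rfl, rfl⟩ | ⟨rfl, rfl, rfl⟩ | ⟨rfl, rfl, rfl⟩ | ⟨rfl, rfl, rfl⟩ |
    ⟨rfl, rfl, rfl⟩ | ⟨rfl, rfl, rfl⟩ <;> simp

/-- Some move leads to `Q`. -/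
def W (a b c : ℕ) : Prop := ∃ x y z, (x, y, z) ∈ moves (a, b, c) ∧ Q (x, y, z)

theorem W_swap12 {a b c : ℕ} (h : W a b c) : W b a c := by
  obtain ⟨x, y, z, h, hQ⟩ := h
  refine ⟨y, x, z, ?_, Q_swap12 hQ⟩
  rw [mem_moves] at h ⊢
  omega

theorem W_swap23 {a b c : ℕ} (h : W a b c) : W a c b := by
  obtain ⟨x, y, z, h, hQ⟩ := h
  refine ⟨x, z, y, ?_, Q_swap23 hQ⟩
  rw [mem_moves] at h ⊢
  omega

theorem W_sorted {a b c : ℕ} (hab : a ≤ b) (hbc : b ≤ c) (h : ¬ Q (a, b, c)) : W a b c := by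
  obtain ⟨u, rfl⟩ := Nat.exists_eq_add_of_le hab
  obtain ⟨v, rfl⟩ := Nat.exists_eq_add_of_le hbc
  rcases Nat.eq_zero_or_pos u with rfl | hu
  · have hv : ¬ E v := fun hv => h ⟨a, v, hv, by simp⟩
    obtain ⟨e, he, rfl, hE⟩ := not_E hv
    refine ⟨a, a + e, a + e, ?_, a, e, hE, by simp⟩
    rw [mem_moves]; omega
  rcases Nat.eq_zero_or_pos v with rfl | hv
  · have hv : ¬ E u := fun hv => h ⟨a, u, hv, by simp⟩
    obtain ⟨e, he, rfl, hE⟩ := not_E hv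
    refine ⟨a + e, a + e, a + e + e, ?_, a + e, e, hE, by simp⟩
    rw [mem_moves]; omega
  rcases le_total u v with huv | huv
  · obtain ⟨w, rfl⟩ := Nat.exists_eq_add_of_le huv
    by_cases hw : E w
    · refine ⟨a + u, a + u, a + u + w, ?_, a + u, w, hw, by simp⟩
      rw [mem_moves]; omega
    · obtain ⟨e, he, rfl, hE⟩ := not_E hw
      refine ⟨a + u + e, a + u, a + u + e, ?_, a + u, e, hE, by simp⟩
      rw [mem_moves]; omega
  · obtain ⟨w, rfl⟩ := Nat.exists_eq_add_of_le huv
    by_cases hw : E w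
    · refine ⟨a + v, a + v + w, a + v + w, ?_, a + v, w, hw, by simp⟩
      rw [mem_moves]; omega
    · obtain ⟨e, he, rfl, hE⟩ := not_E hw
      refine ⟨a + v + e, a + v + e + e, a + v + e, ?_, a + v + e, e, hE, by simp⟩
      rw [mem_moves]; omega

theorem W_of_not_Q {a b c : ℕ} (h : ¬ Q (a, b, c)) : W a b c := by
  rcases le_total a b with h1 | h1 <;> rcases le_total b c with h2 | h2 <;>
    rcases le_total a c with h3 | h3
  · exact W_sorted h1 h2 h
  · exact W_sorted h1 h2 h
  · exact W_swap23 (W_sorted h3 h2 fun hq => h (Q_swap23 hq))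
  · exact W_swap23 (W_swap12 (W_sorted h3 h1 fun hq => h (Q_swap23 (Q_swap12 hq))))
  · exact W_swap12 (W_sorted h1 h3 fun hq => h (Q_swap12 hq))
  · exact W_swap12 (W_swap23 (W_sorted h2 h3 fun hq => h (Q_swap12 (Q_swap23 hq))))
  · exact W_swap12 (W_sorted h1 h3 fun hq => h (Q_swap12 hq))
  · exact W_swap23 (W_swap12 (W_swap23 (W_sorted h2 h1
      fun hq => h (Q_swap23 (Q_swap12 (Q_swap23 hq))))))

theorem G_iff_Q (p : ℕ × ℕ × ℕ) : G p = 0 ↔ Q p := by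
  induction hm : measure3 p using Nat.strong_induction_on generalizing p with
  | _ m ih =>
    subst hm
    rw [G_eq_zero_iff]
    constructor
    · intro h
      by_contra hQ
      obtain ⟨a, b, c⟩ := p
      obtain ⟨x, y, z, hmem, hQ'⟩ := W_of_not_Q hQ
      exact h _ hmem ((ih _ (measure3_lt_of_mem_moves hmem) _ rfl).2 hQ')
    · intro hQ q hq h0
      exact no_move hQ hq ((ih _ (measure3_lt_of_mem_moves hq) _ rfl).1 h0)

theorem Q_sorted {a b c : ℕ} (hab : a ≤ b) (hbc : b ≤ c) (h : Q (a, b, c)) :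
    ∃ d, E d ∧ ((b = a ∧ c = a + d) ∨ (b = a + d ∧ c = a + d)) := by
  obtain ⟨x, d, hd, h⟩ := h
  refine ⟨d, hd, ?_⟩
  simp only [Prod.mk.injEq] at h
  omega

theorem Q_unique {a b c b' c' : ℕ} (hab : a ≤ b) (hbc : b ≤ c) (hab' : a ≤ b') (hbc' : b' ≤ c')
    (h : Q (a, b, c)) (h' : Q (a, b', c')) (hs : b + c = b' + c') : b = b' ∧ c = c' := by
  obtain ⟨d, hd, h⟩ := Q_sorted hab hbc h
  obtain ⟨e, he, h'⟩ := Q_sorted hab' hbc' h'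
  rcases h with h | h <;> rcases h' with h' | h'
  · omega
  · rcases Nat.eq_zero_or_pos e with rfl | h0
    · omega
    · obtain rfl : d = 2 * e := by omega
      exact absurd he ((E_two_mul h0).1 hd)
  · rcases Nat.eq_zero_or_pos d with rfl | h0
    · omega
    · obtain rfl : e = 2 * d := by omega
      exact absurd hd ((E_two_mul h0).1 he)
  · omega

/-- For `n ≥ 1`, there are exactly `⌊n/3⌋` P-positions `(a,b,c)` with
`1 ≤ a ≤ b ≤ c` and `a + b + c = n`. -/
theorem card_P_positions (n : ℕ) (hn : 1 ≤ n) :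
    {p : ℕ × ℕ × ℕ | 1 ≤ p.1 ∧ p.1 ≤ p.2.1 ∧ p.2.1 ≤ p.2.2 ∧
      p.1 + p.2.1 + p.2.2 = n ∧ G p = 0}.ncard = n / 3 := by
  have hI : n / 3 = (↑(Finset.Icc 1 (n / 3)) : Set ℕ).ncard := by
    rw [Set.ncard_coe_finset]; simp
  rw [hI]
  refine Set.ncard_congr (fun p _ => p.1) ?_ ?_ ?_
  · rintro ⟨a, b, c⟩ ⟨h1, h2, h3, h4, h5⟩
    simp only [Finset.coe_Icc, Set.mem_Icc] at *
    omega
  · rintro ⟨a, b, c⟩ ⟨a', b', c'⟩ ⟨h1, h2, h3, h4, h5⟩ ⟨h1', h2', h3', h4', h5'⟩ h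
    rw [G_iff_Q] at h5 h5'
    dsimp only at *
    subst h
    obtain ⟨rfl, rfl⟩ := Q_unique h2 h3 h2' h3' h5 h5' (by omega)
    rfl
  · intro a ha
    simp only [Finset.coe_Icc, Set.mem_Icc] at ha
    obtain ⟨d, hd⟩ : ∃ d, n = 3 * a + d := ⟨n - 3 * a, by omega⟩
    by_cases hE : E d
    · refine ⟨(a, a, a + d), ⟨ha.1, le_rfl, by simp, by dsimp only; omega, ?_⟩, rfl⟩
      exact (G_iff_Q _).2 ⟨a, d, hE, by simp⟩
    · obtain ⟨e, he, rfl, hE'⟩ := not_E hE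
      refine ⟨(a, a + e, a + e), ⟨ha.1, by simp, le_rfl, by dsimp only; omega, ?_⟩, rfl⟩
      exact (G_iff_Q _).2 ⟨a, e, hE', by simp⟩

end SharingNim
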